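/- Let 0 < α < 2, β > 0, γ > 0 and −1 < s ≤ 1 with |s| > α/2. Then for every j ∈ ℤ and 1 ≤ p ≤ ∞, the Littlewood–Paley piece satisfies ‖P_j (E_{α,β}(e^{iπs}|·|^γ))^∨‖_{L^p(ℝ^d)} ≤ C · 2^{d(1−1/p) j + δ(j)}, where δ(j) = −γj for j > 0 and δ(j) = 0 for j ≤ 0, with C independent of j. -/

import Mathlib

open Real Complex MeasureTheory FourierTransform
open scoped ENNReal

/-- The two-parameter Mittag-Leffler function `E_{α,β}(z) = Σ_{k≥0} z^k / Γ(αk + β)`. -/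
noncomputable def mittagLeffler (α β : ℝ) (z : ℂ) : ℂ :=
  ∑' k : ℕ, z ^ k / Complex.Gamma ((α * k + β : ℝ) : ℂ)



/-- class of entire functions with decay on a strip -/
def SB (f : ℂ → ℂ) : Prop := Differentiable ℂ f ∧ ∃ ε > 0, ∃ C : ℝ, 0 ≤ C ∧
  ∀ w : ℂ, |w.im| < ε → ‖f w‖ ≤ C / (1 + Real.exp w.re)

lemma SB.deriv {f : ℂ → ℂ} (h : SB f) : SB (deriv f) := by
  obtain ⟨hd, ε, hε, C, hC, hb⟩ := h
  refine ⟨hd.deriv, ε / 2, by positivity, C * Real.exp (ε/4) / (ε/4), by positivity, ?_⟩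
  intro w hw
  have h1 : ∀ z ∈ Metric.sphere w (ε/4), ‖f z‖ ≤ C * Real.exp (ε/4) / (1 + Real.exp w.re) := by
    intro z hz
    have hz' : ‖z - w‖ = ε/4 := by simpa [dist_eq_norm] using hz
    have him : |z.im - w.im| ≤ ε/4 := by
      rw [← hz', ← Complex.sub_im]; exact Complex.abs_im_le_norm _
    have hre : |z.re - w.re| ≤ ε/4 := by
      rw [← hz', ← Complex.sub_re]; exact Complex.abs_re_le_norm _
    have him2 : |z.im| < ε := by
      rw [abs_lt] at *; rw [abs_le] at him; constructor <;> linarith [him.1, him.2, hw.1, hw.2]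
    refine (hb z him2).trans ?_
    rw [div_le_div_iff₀ (by positivity) (by positivity)]
    have h2 : Real.exp w.re ≤ Real.exp (ε/4) * Real.exp z.re := by
      rw [← Real.exp_add]; apply Real.exp_le_exp.2; rw [abs_le] at hre; linarith [hre.1]
    have h3 : 1 ≤ Real.exp (ε/4) := Real.one_le_exp (by positivity)
    nlinarith
  have := Complex.norm_deriv_le_of_forall_mem_sphere_norm_le (by positivity : 0 < ε/4) 
    hd.diffContOnCl h1
  refine this.trans (le_of_eq ?_)
  ring

lemma SB.comb {f g : ℂ → ℂ} (hf : SB f) (hg : SB g) (a b : ℂ) : SB (fun w => a * f w + b * g w) := by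
  obtain ⟨hd, ε, hε, C, hC, hb⟩ := hf
  obtain ⟨hd', ε', hε', C', hC', hb'⟩ := hg
  refine ⟨by fun_prop, min ε ε', lt_min hε hε', ‖a‖ * C + ‖b‖ * C', by positivity, ?_⟩
  intro w hw
  have h1 := hb w (hw.trans_le (min_le_left _ _))
  have h2 := hb' w (hw.trans_le (min_le_right _ _))
  calc _ ≤ ‖a‖ * ‖f w‖ + ‖b‖ * ‖g w‖ := by
        refine (norm_add_le _ _).trans ?_; simp
    _ ≤ ‖a‖ * (C / (1 + Real.exp w.re)) + ‖b‖ * (C' / (1 + Real.exp w.re)) := by gcongr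
    _ = _ := by ring

lemma SB.smooth {f : ℂ → ℂ} (hf : SB f) (a γ : ℝ) :
    ContDiff ℝ (⊤:ℕ∞) (fun t : ℝ => f ((a + γ * t : ℝ) : ℂ)) := by
  have h1 : ContDiff ℂ (⊤:ℕ∞) f := hf.1.contDiff
  have h2 : ContDiff ℝ (⊤:ℕ∞) f := h1.restrict_scalars ℝ
  have h3 : ContDiff ℝ (⊤:ℕ∞) (fun t : ℝ => ((a + γ * t : ℝ) : ℂ)) :=
    Complex.ofRealCLM.contDiff.comp (by fun_prop : ContDiff ℝ (⊤:ℕ∞) (fun t : ℝ => a + γ * t))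
  exact h2.comp h3

lemma SB.iter {f : ℂ → ℂ} (hf : SB f) (γ : ℝ) (n : ℕ) : ∃ g, SB g ∧ ∀ a t : ℝ,
    iteratedDeriv n (fun t : ℝ => f ((a + γ * t : ℝ) : ℂ)) t = g ((a + γ * t : ℝ) : ℂ) := by
  induction n generalizing f with
  | zero => exact ⟨f, hf, fun a t => by simp⟩
  | succ n ih =>
    have hg : SB (fun w => (γ:ℂ) * _root_.deriv f w + 0 * f w) := hf.deriv.comb hf _ _
    obtain ⟨g, hg1, hg2⟩ := ih hg
    refine ⟨g, hg1, fun a t => ?_⟩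
    rw [iteratedDeriv_succ', ← hg2]
    congr 1
    funext t
    have h1 : HasDerivAt (fun t : ℝ => ((a + γ * t : ℝ) : ℂ)) (γ:ℂ) t := by
      have : HasDerivAt (fun t : ℝ => a + γ * t) γ t := by
        simpa using ((hasDerivAt_id t).const_mul γ).const_add a
      exact this.ofReal_comp
    have h2 := (hf.1 ((a + γ * t : ℝ) : ℂ)).hasDerivAt
    have h3 := HasDerivAt.comp t h2 h1
    have := h3.deriv
    simp only [Function.comp_def] at this
    rw [this]; ring

/-- the uniform bound -/
lemma SB.unif {f : ℂ → ℂ} (hf : SB f) (γ M : ℝ) (hγ : 0 < γ) (hM : 0 ≤ M) :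
    ∃ C : ℝ, 0 ≤ C ∧ ∀ (j : ℤ) (t : ℝ), |t| ≤ M →
      ‖f ((γ * (j * Real.log 2) + γ * t : ℝ) : ℂ)‖ ≤ C * (2:ℝ) ^ (if 0 < j then -γ * (j:ℝ) else 0) := by
  obtain ⟨hd, ε, hε, C, hC, hb⟩ := hf
  refine ⟨C * Real.exp (γ * M), by positivity, fun j t ht => ?_⟩
  have h1 := hb ((γ * (j * Real.log 2) + γ * t : ℝ) : ℂ) (by rw [Complex.ofReal_im]; simpa using hε)
  refine h1.trans ?_
  rw [Complex.ofReal_re, mul_assoc, div_eq_mul_inv]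
  gcongr
  rw [Real.rpow_def_of_pos (by norm_num), ← Real.exp_add, inv_le_comm₀ (by positivity) (by positivity), ← Real.exp_neg]
  have ht2 : -(γ * M) ≤ γ * t := by rw [abs_le] at ht; nlinarith [ht.1]
  split_ifs with h
  · have : Real.exp (-(γ * M + Real.log 2 * (-γ * (j:ℝ)))) ≤ Real.exp (γ * (j * Real.log 2) + γ * t) := by
      apply Real.exp_le_exp.2; nlinarith
    linarith
  · have : Real.exp (-(γ * M + Real.log 2 * 0)) ≤ 1 := by
      apply Real.exp_le_one_iff.2; nlinarith
    linarith [Real.exp_pos (γ * (j * Real.log 2) + γ * t)]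


lemma intg_aux (a r : ℝ) (ha : -1 < a) (hr : 0 < r) :
    IntegrableOn (fun t : ℝ => t ^ a * Real.exp (-r * t)) (Set.Ioi 0) := by
  have := integrableOn_rpow_mul_exp_neg_mul_rpow (p := 1) ha zero_lt_one hr
  simpa using this

lemma norm_aux (a : ℝ) (r : ℂ) (t : ℝ) (ht : 0 < t) :
    ‖((t ^ a : ℝ) : ℂ) * cexp (-(r * t))‖ = t ^ a * Real.exp (-r.re * t) := by
  rw [norm_mul, Complex.norm_exp, Complex.norm_real, Real.norm_of_nonneg (by positivity)]
  simp

lemma meas_aux (a : ℝ) (r : ℂ) : Measurable (fun t : ℝ => ((t ^ a : ℝ) : ℂ) * cexp (-(r * t))) := by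
  fun_prop

lemma intg_aux2 (a : ℝ) (r : ℂ) (ha : -1 < a) (hr : 0 < r.re) :
    IntegrableOn (fun t : ℝ => ((t ^ a : ℝ) : ℂ) * cexp (-(r * t))) (Set.Ioi 0) := by
  refine Integrable.mono' (intg_aux a r.re ha hr) (meas_aux a r).aestronglyMeasurable ?_
  filter_upwards [ae_restrict_mem measurableSet_Ioi] with t ht
  exact (norm_aux a r t ht).le

lemma laplace_diff (a : ℝ) (ha : 0 < a) :
    DifferentiableOn ℂ (fun r : ℂ => ∫ t in Set.Ioi (0:ℝ), ((t ^ (a-1) : ℝ) : ℂ) * cexp (-(r * t)))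
      {r : ℂ | 0 < r.re} := by
  intro r0 hr0
  apply DifferentiableAt.differentiableWithinAt
  have hr0' : 0 < r0.re := hr0
  have hs : {r : ℂ | r0.re / 2 < r.re} ∈ nhds r0 := by
    apply (isOpen_lt continuous_const Complex.continuous_re).mem_nhds
    simp; linarith
  have := hasDerivAt_integral_of_dominated_loc_of_deriv_le (μ := volume.restrict (Set.Ioi (0:ℝ)))
    (F := fun (r : ℂ) (t : ℝ) => ((t ^ (a-1) : ℝ) : ℂ) * cexp (-(r * t)))
    (F' := fun (r : ℂ) (t : ℝ) => ((t ^ (a-1) : ℝ) : ℂ) * (cexp (-(r * t)) * -(1 * t)))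
    (bound := fun t : ℝ => t ^ a * Real.exp (-(r0.re/2) * t)) hs
    (Filter.Eventually.of_forall fun r => (meas_aux _ r).aestronglyMeasurable)
    (intg_aux2 (a-1) r0 (by linarith) hr0')
    (by apply Measurable.aestronglyMeasurable; fun_prop)
    (by
      filter_upwards [ae_restrict_mem measurableSet_Ioi] with t ht r hr
      have ht : 0 < t := ht
      have hr : r0.re / 2 < r.re := hr
      rw [← mul_assoc, norm_mul, norm_aux _ _ _ ht]
      have : t ^ a = t ^ (a-1) * t := by rw [← Real.rpow_add_one ht.ne']; simp
      rw [this]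
      simp only [one_mul, norm_neg, Complex.norm_real, Real.norm_of_nonneg ht.le]
      have : Real.exp (-r.re * t) ≤ Real.exp (-(r0.re/2) * t) := by
        apply Real.exp_le_exp.2; nlinarith
      calc _ = t ^ (a-1) * t * Real.exp (-r.re * t) := by ring
        _ ≤ _ := by gcongr)
    (intg_aux a _ (by linarith) (by linarith))
    (by
      filter_upwards with t r hr
      apply HasDerivAt.const_mul
      apply HasDerivAt.cexp
      exact ((hasDerivAt_id r).mul_const (t:ℂ)).neg)
  exact this.2.differentiableAt

lemma laplace (a : ℝ) (ha : 0 < a) (r : ℂ) (hr : 0 < r.re) :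
    ∫ t in Set.Ioi (0:ℝ), ((t ^ (a-1) : ℝ) : ℂ) * cexp (-(r * t)) = r ^ (-a : ℂ) * Complex.Gamma a := by
  have hopen : IsOpen {r : ℂ | 0 < r.re} := isOpen_lt continuous_const Complex.continuous_re
  have h1 := (laplace_diff a ha).analyticOnNhd hopen
  have h2 : AnalyticOnNhd ℂ (fun r : ℂ => r ^ (-a : ℂ) * Complex.Gamma a) {r : ℂ | 0 < r.re} := by
    apply DifferentiableOn.analyticOnNhd _ hopen
    intro r hr
    apply DifferentiableAt.differentiableWithinAt
    apply DifferentiableAt.mul_const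
    exact (differentiableAt_id).cpow_const (Or.inl hr)
  have hpre : IsPreconnected {r : ℂ | 0 < r.re} := (convex_halfSpace_re_gt 0).isPreconnected
  refine h1.eqOn_of_preconnected_of_frequently_eq h2 hpre (z₀ := 1) (by simp) ?_ hr
  have key : ∀ x : ℝ, 0 < x → ∫ t in Set.Ioi (0:ℝ), ((t ^ (a-1) : ℝ) : ℂ) * cexp (-((x:ℂ) * t)) = (x:ℂ) ^ (-a : ℂ) * Complex.Gamma a := by
    intro x hx
    have := Complex.integral_cpow_mul_exp_neg_mul_Ioi (a := a) (r := x) (by simpa) hx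
    rw [one_div, ← Complex.ofReal_inv, ← Complex.ofReal_cpow (by positivity), Real.inv_rpow hx.le, ← Real.rpow_neg hx.le,
      Complex.ofReal_cpow hx.le] at this
    push_cast at this ⊢
    rw [← this]
    apply setIntegral_congr_fun measurableSet_Ioi
    intro t ht
    have ht : 0 < t := ht
    simp only
    congr 1
    rw [Complex.ofReal_cpow ht.le]; simp
  have hseq : Filter.Tendsto (fun x : ℝ => (x:ℂ)) (nhdsWithin 1 (Set.Ioi 1)) (nhdsWithin 1 {1}ᶜ) := by
    apply tendsto_nhdsWithin_of_tendsto_nhds_of_eventually_within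
    · have : Filter.Tendsto (fun x : ℝ => (x:ℂ)) (nhds 1) (nhds ((1:ℝ):ℂ)) := Complex.continuous_ofReal.tendsto 1
      simpa using this.mono_left nhdsWithin_le_nhds
    · filter_upwards [self_mem_nhdsWithin] with x hx
      have hx : 1 < x := hx
      simp; norm_cast; exact hx.ne'
  refine hseq.frequently (Filter.Eventually.frequently ?_)
  filter_upwards [self_mem_nhdsWithin] with x hx
  have hx : 1 < x := hx
  exact key x (by linarith)

/-- the vertical line -/
noncomputable def pl (y : ℝ) : ℂ := 1 + 2 * π * I * y

lemma pl_re (y : ℝ) : (pl y).re = 1 := by simp [pl]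
lemma pl_im (y : ℝ) : (pl y).im = 2 * π * y := by simp [pl]
lemma pl_ne (y : ℝ) : pl y ≠ 0 := by
  intro h; have := pl_re y; rw [h] at this; simp at this
lemma pl_cont : Continuous pl := by unfold pl; fun_prop
lemma pl_norm (y : ℝ) : 1 ≤ ‖pl y‖ := by
  have := Complex.abs_re_le_norm (pl y); rwa [pl_re, abs_one] at this
lemma pl_norm2 (y : ℝ) : (1 + ‖y‖) / 2 ≤ ‖pl y‖ := by
  have h := Complex.abs_im_le_norm (pl y)
  rw [pl_im, abs_mul, abs_of_pos (by positivity)] at h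
  have := pl_norm y
  have h3 := Real.pi_gt_three
  rw [Real.norm_eq_abs]
  nlinarith [abs_nonneg y]
lemma pl_cpow_norm (y a : ℝ) : ‖pl y ^ (a:ℂ)‖ = ‖pl y‖ ^ a := 
  Complex.norm_cpow_real _ _
lemma pl_slit (y : ℝ) : pl y ∈ Complex.slitPlane := Or.inl (by rw [pl_re]; norm_num)
lemma pl_cpow_cont (a : ℂ) : Continuous (fun y => pl y ^ a) := by
  apply pl_cont.cpow continuous_const; intro y; exact pl_slit y
lemma pl_int (a : ℝ) (ha : 1 < a) : Integrable (fun y => ‖pl y‖ ^ (-a)) := by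
  have h := integrable_one_add_norm (E := ℝ) (μ := volume) (r := a) (by simpa)
  refine Integrable.mono' (h.const_mul ((2:ℝ)^a)) ?_ ?_
  · exact ((pl_cont.norm).rpow_const (fun y => Or.inl (norm_ne_zero_iff.2 (pl_ne y)))).aestronglyMeasurable
  · filter_upwards with y
    rw [Real.norm_of_nonneg (by positivity)]
    have := Real.rpow_le_rpow_of_nonpos (by positivity) (pl_norm2 y) (by linarith : -a ≤ 0)
    refine this.trans (le_of_eq ?_)
    rw [Real.div_rpow (by positivity) (by norm_num), Real.rpow_neg (by norm_num : (0:ℝ) ≤ 2)]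
    field_simp

lemma brom (a : ℝ) (ha : 1 < a) :
    ∫ y : ℝ, cexp (pl y) * pl y ^ (-a : ℂ) = 1 / Complex.Gamma a := by
  set f : ℝ → ℂ := (Set.Ioi (0:ℝ)).indicator (fun t => ((t ^ (a-1) : ℝ) : ℂ) * cexp (-((1:ℂ) * t))) with hf
  have hfi : Integrable f := (integrable_indicator_iff measurableSet_Ioi).2 (intg_aux2 (a-1) 1 (by linarith) (by simp))
  have hF : 𝓕 f = fun y => pl y ^ (-a : ℂ) * Complex.Gamma a := by
    funext y
    rw [Real.fourier_real_eq_integral_exp_smul, ← laplace a (by linarith) (pl y) (by rw [pl_re]; norm_num), ← integral_indicator measurableSet_Ioi]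
    congr 1
    funext t
    by_cases ht : t ∈ Set.Ioi (0:ℝ)
    · simp only [hf, Set.indicator_of_mem ht, smul_eq_mul]
      rw [mul_left_comm, ← Complex.exp_add]
      congr 2
      simp [pl]; ring
    · simp [hf, Set.indicator_of_notMem ht]
  have hFi : Integrable (𝓕 f) := by
    rw [hF]
    apply Integrable.mul_const
    refine Integrable.mono' (pl_int a ha) (pl_cpow_cont _).aestronglyMeasurable ?_
    filter_upwards with y
    rw [← Complex.ofReal_neg, pl_cpow_norm]
  have hc : ContinuousAt f 1 := by
    have : (fun t : ℝ => ((t ^ (a-1) : ℝ) : ℂ) * cexp (-((1:ℂ) * t))) =ᶠ[nhds 1] f := by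
      filter_upwards [Ioi_mem_nhds (zero_lt_one)] with t ht
      simp [hf, Set.indicator_of_mem ht]
    refine ContinuousAt.congr ?_ this
    have : ContinuousAt (fun t : ℝ => t ^ (a-1)) 1 := Real.continuousAt_rpow_const _ _ (Or.inl one_ne_zero)
    exact (Complex.continuous_ofReal.continuousAt.comp this).mul (by fun_prop)
  have h := hfi.fourierInv_fourier_eq hFi hc
  rw [hF, Real.fourierInv_eq'] at h
  have h1 : f 1 = cexp (-1) := by simp [hf]
  rw [h1] at h
  have hg : Complex.Gamma a ≠ 0 := Complex.Gamma_ne_zero_of_re_pos (by simp; linarith)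
  have h2 : ∀ y : ℝ, cexp (((2 * π * inner ℝ y (1:ℝ) : ℝ) : ℂ) * I) • (pl y ^ (-a : ℂ) * Complex.Gamma a)
     = (Complex.Gamma a * cexp (-1)) * (cexp (pl y) * pl y ^ (-a : ℂ)) := by
    intro y
    have : cexp (pl y) = cexp 1 * cexp (((2 * π * inner ℝ y (1:ℝ) : ℝ) : ℂ) * I) := by
      rw [← Complex.exp_add]; congr 1; simp [pl]; ring
    rw [this]
    have h3 : cexp (-1) * cexp 1 = 1 := by rw [← Complex.exp_add]; simp
    rw [smul_eq_mul]
    linear_combination (-(Complex.Gamma a * cexp (((2 * π * inner ℝ y (1:ℝ) : ℝ) : ℂ) * I) * pl y ^ (-a : ℂ))) * h3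
  simp_rw [h2] at h
  rw [integral_const_mul] at h
  rw [eq_div_iff hg]
  have := Complex.exp_ne_zero (-1)
  apply mul_left_cancel₀ this
  linear_combination h

lemma gamma_lb (a c : ℝ) (ha : 1 ≤ a) (hc : 0 < c) : c ^ (a-1) * Real.exp (-(c+1)) ≤ Real.Gamma a := by
  rw [Real.Gamma_eq_integral (by linarith)]
  have hi := Real.GammaIntegral_convergent (s := a) (by linarith)
  have hsub : Set.Ioc c (c+1) ⊆ Set.Ioi 0 := fun x hx => lt_trans hc hx.1
  calc c ^ (a-1) * Real.exp (-(c+1)) = ∫ x in Set.Ioc c (c+1), c ^ (a-1) * Real.exp (-(c+1)) := by simp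
    _ ≤ ∫ x in Set.Ioc c (c+1), Real.exp (-x) * x ^ (a-1) := by
      apply setIntegral_mono_on (integrableOn_const (by simp)) (hi.mono_set hsub) measurableSet_Ioc
      intro x hx
      rw [mul_comm]
      have h1 : c ^ (a-1) ≤ x ^ (a-1) := Real.rpow_le_rpow hc.le hx.1.le (by linarith)
      have h2 : Real.exp (-(c+1)) ≤ Real.exp (-x) := Real.exp_le_exp.2 (by linarith [hx.2])
      gcongr
    _ ≤ _ := by
      apply setIntegral_mono_set hi
      · filter_upwards [ae_restrict_mem measurableSet_Ioi] with x hx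
        have hx : 0 < x := hx
        simp; positivity
      · exact hsub.eventuallyLE

lemma ml_summable (α β x : ℝ) (hα : 0 < α) (hβ : 0 < β) (hx : 0 ≤ x) :
    Summable (fun k : ℕ => x ^ k / Real.Gamma (α * k + β)) := by
  set c : ℝ := (2 * (x+1)) ^ (1/α) with hc
  have hc0 : 0 < c := by positivity
  have hcα : c ^ α = 2 * (x + 1) := by
    rw [hc, ← Real.rpow_mul (by positivity)]; field_simp; simp
  have hs : Summable (fun k : ℕ => (Real.exp (c+1) * c ^ (1-β)) * (1/2:ℝ) ^ k) :=
    (summable_geometric_of_lt_one (by norm_num) (by norm_num)).mul_left _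
  refine Summable.of_norm_bounded_eventually_nat hs ?_
  have : Filter.Tendsto (fun k : ℕ => α * (k:ℝ)) Filter.atTop Filter.atTop :=
    tendsto_natCast_atTop_atTop.const_mul_atTop hα
  filter_upwards [this.eventually_ge_atTop 1] with k hk
  have hg := gamma_lb (α * k + β) c (by linarith) hc0
  have hgp : 0 < Real.Gamma (α * k + β) := Real.Gamma_pos_of_pos (by linarith)
  rw [Real.norm_of_nonneg (by positivity), div_le_iff₀ hgp]
  have e1 : c ^ (α * k + β - 1) = (2 * (x+1)) ^ k * (c ^ (1-β))⁻¹ := by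
    rw [← hcα, ← Real.rpow_natCast, ← Real.rpow_mul hc0.le, ← Real.rpow_neg hc0.le, ← Real.rpow_add hc0]
    congr 1; ring
  have e2 : Real.exp (c+1) * Real.exp (-(c+1)) = 1 := by rw [← Real.exp_add]; simp
  have e3 : c ^ (1-β) ≠ 0 := by positivity
  calc x ^ k ≤ (x+1) ^ k := by gcongr; linarith
    _ = Real.exp (c+1) * c ^ (1-β) * (1/2:ℝ)^k * (c ^ (α * k + β - 1) * Real.exp (-(c+1))) := by
      rw [e1]
      rw [mul_pow, one_div, inv_pow]
      have : (2:ℝ)^k ≠ 0 := by positivity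
      field_simp
      exact e2.symm
    _ ≤ _ := by gcongr

noncomputable def mlF (α β : ℝ) (ω : ℂ) (k : ℕ) (w : ℂ) : ℂ :=
  (ω * cexp w) ^ k / Complex.Gamma ((α * k + β : ℝ) : ℂ)

lemma mlF_norm (α β : ℝ) (hα : 0 < α) (hβ : 0 < β) (ω : ℂ) (hω : ‖ω‖ = 1) (k : ℕ) (w : ℂ) :
    ‖mlF α β ω k w‖ = (Real.exp w.re) ^ k / Real.Gamma (α * k + β) := by
  unfold mlF
  rw [norm_div, norm_pow, norm_mul, hω, one_mul, Complex.norm_exp, Complex.Gamma_ofReal, Complex.norm_real,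
    Real.norm_of_nonneg]
  exact (Real.Gamma_pos_of_pos (by positivity)).le

lemma mlF_bound (α β : ℝ) (hα : 0 < α) (hβ : 0 < β) (ω : ℂ) (hω : ‖ω‖ = 1) (R : ℝ) (k : ℕ) (w : ℂ) (hw : w.re < R) :
    ‖mlF α β ω k w‖ ≤ (Real.exp R) ^ k / Real.Gamma (α * k + β) := by
  rw [mlF_norm α β hα hβ ω hω]
  have : 0 < Real.Gamma (α * k + β) := (Real.Gamma_pos_of_pos (by positivity))
  gcongr

lemma mlF_deriv (α β : ℝ) (ω : ℂ) (k : ℕ) (w : ℂ) : HasDerivAt (mlF α β ω k) (k * mlF α β ω k w) w := by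
  have h : mlF α β ω k = fun w => (ω ^ k / Complex.Gamma ((α * k + β : ℝ) : ℂ)) * cexp (k * w) := by
    funext w; unfold mlF; rw [mul_pow, ← Complex.exp_nat_mul]; ring
  rw [h]
  have := ((((hasDerivAt_id w).const_mul (k:ℂ)).cexp).const_mul (ω ^ k / Complex.Gamma ((α * k + β : ℝ) : ℂ)))
  refine this.congr_deriv ?_
  simp only [id, mul_one]; ring

lemma mlF_open (R : ℝ) : IsOpen {w : ℂ | w.re < R} := isOpen_lt Complex.continuous_re continuous_const

lemma ml_entire (α β : ℝ) (hα : 0 < α) (hβ : 0 < β) (ω : ℂ) (hω : ‖ω‖ = 1) :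
    Differentiable ℂ (fun w => mittagLeffler α β (ω * cexp w)) := by
  intro w
  have := Complex.differentiableOn_tsum_of_summable_norm (U := {z : ℂ | z.re < w.re + 1}) (F := mlF α β ω)
    (ml_summable α β (Real.exp (w.re+1)) hα hβ (by positivity))
    (fun i z _ => (mlF_deriv α β ω i z).differentiableAt.differentiableWithinAt) (mlF_open _)
    (fun i z hz => mlF_bound α β hα hβ ω hω _ i z hz)
  exact (this w (by simp)).differentiableAt ((mlF_open _).mem_nhds (by simp))

lemma ml_rec (α β : ℝ) (hα : 0 < α) (hβ : 0 < β) (ω : ℂ) (hω : ‖ω‖ = 1) (w : ℂ) :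
    mittagLeffler α β (ω * cexp w) = (α:ℂ) * deriv (fun w => mittagLeffler α (β+1) (ω * cexp w)) w
      + (β:ℂ) * mittagLeffler α (β+1) (ω * cexp w) := by
  have h1 := Complex.hasSum_deriv_of_summable_norm (U := {z : ℂ | z.re < w.re + 1}) (F := mlF α (β+1) ω) (z := w)
    (ml_summable α (β+1) (Real.exp (w.re+1)) hα (by positivity) (by positivity))
    (fun i z _ => (mlF_deriv α (β+1) ω i z).differentiableAt.differentiableWithinAt) (mlF_open _)
    (fun i z hz => mlF_bound α (β+1) hα (by positivity) ω hω _ i z hz) (by simp)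
  have h2 : HasSum (fun k => mlF α (β+1) ω k w) (mittagLeffler α (β+1) (ω * cexp w)) := by
    apply Summable.hasSum
    apply Summable.of_norm_bounded (ml_summable α (β+1) (Real.exp (w.re+1)) hα (by positivity) (by positivity))
    intro i
    exact mlF_bound α (β+1) hα (by positivity) ω hω _ i w (by linarith)
  have h3 := (h1.mul_left (α:ℂ)).add (h2.mul_left (β:ℂ))
  have h4 : (fun w => mittagLeffler α (β+1) (ω * cexp w)) = (fun w => ∑' i, mlF α (β+1) ω i w) := rfl
  rw [h4, ← h3.tsum_eq]
  unfold mittagLeffler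
  congr 1
  funext k
  rw [(mlF_deriv α (β+1) ω k w).deriv]
  unfold mlF
  have h5 : ((α * k + (β + 1) : ℝ) : ℂ) = ((α * k + β : ℝ) : ℂ) + 1 := by push_cast; ring
  have h6 : ((α * k + β : ℝ) : ℂ) ≠ 0 := by
    have : 0 < α * k + β := by positivity
    exact_mod_cast this.ne'
  have h7 : Complex.Gamma ((α * k + β : ℝ) : ℂ) ≠ 0 := Complex.Gamma_ne_zero_of_re_pos (by rw [Complex.ofReal_re]; positivity)
  rw [h5, Complex.Gamma_add_one _ h6]
  field_simp
  push_cast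
  ring

lemma polar_lb (A B a b κ : ℝ) (hA : 0 ≤ A) (hB : 0 ≤ B) (hκ : 0 ≤ κ) (hκ1 : κ < 1) (h : Real.cos (a - b) ≤ κ) :
    √((1-κ)/2) * (A + B) ≤ ‖(A:ℂ) * cexp (a * I) - B * cexp (b * I)‖ := by
  apply le_of_sq_le_sq _ (norm_nonneg _)
  rw [mul_pow, Real.sq_sqrt (by linarith), ← Complex.normSq_eq_norm_sq, Complex.normSq_apply]
  simp only [Complex.sub_re, Complex.sub_im, Complex.re_ofReal_mul, Complex.im_ofReal_mul,
    Complex.exp_ofReal_mul_I_re, Complex.exp_ofReal_mul_I_im]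
  rw [Real.cos_sub] at h
  have ha := Real.sin_sq_add_cos_sq a
  have hb := Real.sin_sq_add_cos_sq b
  have h1 : (A * Real.cos a - B * Real.cos b) * (A * Real.cos a - B * Real.cos b) +
      (A * Real.sin a - B * Real.sin b) * (A * Real.sin a - B * Real.sin b)
      = A^2 + B^2 - 2 * (A * B) * (Real.cos a * Real.cos b + Real.sin a * Real.sin b) := by
    linear_combination A^2 * ha + B^2 * hb
  rw [h1]
  have h2 : A * B * (Real.cos a * Real.cos b + Real.sin a * Real.sin b) ≤ A * B * κ := by gcongr
  nlinarith [sq_nonneg (A - B), mul_nonneg hκ (sq_nonneg (A-B))]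

lemma cos_bd (x ε : ℝ) (hε : 0 < ε) (h1 : ε ≤ |x|) (h2 : |x| ≤ 2 * π - ε) : Real.cos x ≤ Real.cos ε := by
  rw [← Real.cos_abs x]
  rcases le_total |x| π with h | h
  · exact Real.cos_le_cos_of_nonneg_of_le_pi hε.le h h1
  · rw [← Real.cos_two_pi_sub]
    exact Real.cos_le_cos_of_nonneg_of_le_pi hε.le (by linarith) (by linarith)

lemma den_lb (α s : ℝ) (hα : 0 < α) (hα2 : α < 2)
    (hs1 : -1 < s) (hs2 : s ≤ 1) (hs3 : α / 2 < |s|) : ∃ ε > 0, ∃ c > 0, ∀ (w : ℂ) (y : ℝ), |w.im| < ε →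
     c * (‖pl y‖ ^ α + Real.exp w.re) ≤ ‖pl y ^ (α:ℂ) - cexp (π * s * I) * cexp w‖ := by
  have hpi := Real.pi_pos
  obtain ⟨ε, hε, hε1, hε2, hε3⟩ : ∃ ε > 0, 2 * ε ≤ π * (|s| - α/2) ∧ 2 * ε ≤ π * (1 - α/2) ∧ ε ≤ π/2 := by
    have h1 : 0 < π * (|s| - α/2) := mul_pos hpi (by linarith)
    have h2 : 0 < π * (1 - α/2) := mul_pos hpi (by linarith)
    refine ⟨min (min (π * (|s| - α/2)/2) (π * (1 - α/2)/2)) (π/2), by positivity, ?_, ?_, min_le_right _ _⟩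
    · linarith [(min_le_left (min (π * (|s| - α/2)/2) (π * (1 - α/2)/2)) (π/2)).trans (min_le_left _ _)]
    · linarith [(min_le_left (min (π * (|s| - α/2)/2) (π * (1 - α/2)/2)) (π/2)).trans (min_le_right _ _)]
  have hκ0 : 0 ≤ Real.cos ε := Real.cos_nonneg_of_neg_pi_div_two_le_of_le (by linarith) hε3
  have hκ1 : Real.cos ε < 1 := by
    have := Real.cos_lt_cos_of_nonneg_of_le_pi le_rfl (by linarith) hε
    simpa using this
  refine ⟨ε, hε, √((1-Real.cos ε)/2), Real.sqrt_pos.2 (by linarith), fun w y hw => ?_⟩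
  set θ := (pl y).arg with hθ
  have hθ2 : |θ| ≤ π/2 := Complex.abs_arg_le_pi_div_two_iff.2 (by rw [pl_re]; norm_num)
  have e1 : pl y ^ (α:ℂ) = ((‖pl y‖ ^ α : ℝ) : ℂ) * cexp ((α * θ : ℝ) * I) := by
    rw [Complex.cpow_def_of_ne_zero (pl_ne y), Complex.log, ← hθ, Real.rpow_def_of_pos (norm_pos_iff.2 (pl_ne y)),
      Complex.ofReal_exp, ← Complex.exp_add]
    congr 1; push_cast; ring
  have e2 : cexp (π * s * I) * cexp w = ((Real.exp w.re : ℝ) : ℂ) * cexp ((π * s + w.im : ℝ) * I) := by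
    conv_lhs => rw [← Complex.re_add_im w]
    rw [Complex.ofReal_exp, ← Complex.exp_add, ← Complex.exp_add]
    congr 1; push_cast; ring
  rw [e1, e2]
  apply polar_lb _ _ _ _ _ (by positivity) (by positivity) hκ0 hκ1
  have hab : |s| ≤ 1 := abs_le.2 ⟨hs1.le, hs2⟩
  have h3 : |α * θ| ≤ α * (π/2) := by rw [abs_mul, abs_of_pos hα]; gcongr
  have h4 : |π * s| = π * |s| := by rw [abs_mul, abs_of_pos hpi]
  have h5 : |π * s| ≤ |α * θ - (π * s + w.im)| + |α * θ| + |w.im| := by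
    have : π * s = -(α * θ - (π * s + w.im)) + α * θ - w.im := by ring
    calc |π * s| = |-(α * θ - (π * s + w.im)) + α * θ - w.im| := by rw [← this]
      _ ≤ |-(α * θ - (π * s + w.im)) + α * θ| + |w.im| := abs_sub _ _
      _ ≤ |-(α * θ - (π * s + w.im))| + |α * θ| + |w.im| := by gcongr; exact abs_add_le _ _
      _ = _ := by rw [abs_neg]
  have h6 : |α * θ - (π * s + w.im)| ≤ |α * θ| + (|π * s| + |w.im|) :=
    (abs_sub _ _).trans (by gcongr; exact abs_add_le _ _)
  apply cos_bd _ _ hε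
  · nlinarith
  · nlinarith

noncomputable def kerF (α β s : ℝ) (w : ℂ) (y : ℝ) : ℂ :=
  cexp (pl y) * pl y ^ ((α - β : ℝ) : ℂ) * (pl y ^ (α:ℂ) - cexp (π * s * I) * cexp w)⁻¹

lemma exp_pl (y : ℝ) : ‖cexp (pl y)‖ = Real.exp 1 := by rw [Complex.norm_exp, pl_re]

lemma norm_omega (s : ℝ) : ‖cexp (π * s * I)‖ = 1 := by
  have := Complex.norm_exp_ofReal_mul_I (π * s); push_cast at this; exact this

lemma ker_main (α β s : ℝ) (hα : 0 < α) (hβ : α + 1 < β) (ε c : ℝ) (hε : 0 < ε) (hc : 0 < c)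
    (hlb : ∀ (w : ℂ) (y : ℝ), |w.im| < ε →
     c * (‖pl y‖ ^ α + Real.exp w.re) ≤ ‖pl y ^ (α:ℂ) - cexp (π * s * I) * cexp w‖) :
    DifferentiableOn ℂ (fun w => ∫ y, kerF α β s w y) {w : ℂ | |w.im| < ε} ∧
    ∃ C, 0 ≤ C ∧ ∀ w : ℂ, |w.im| < ε → ‖∫ y, kerF α β s w y‖ ≤ C / (1 + Real.exp w.re) := by
  have hint : Integrable (fun y => ‖pl y‖ ^ (α - β)) := by
    have := pl_int (β - α) (by linarith); simpa using this
  have hpos : ∀ y, 1 ≤ ‖pl y‖ ^ α := fun y => Real.one_le_rpow (pl_norm y) hα.le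
  have hdpos : ∀ (w : ℂ) (y : ℝ), |w.im| < ε → 0 < ‖pl y ^ (α:ℂ) - cexp (π * s * I) * cexp w‖ := by
    intro w y hw
    refine lt_of_lt_of_le ?_ (hlb w y hw)
    have := hpos y
    positivity
  have hne : ∀ (w : ℂ) (y : ℝ), |w.im| < ε → pl y ^ (α:ℂ) - cexp (π * s * I) * cexp w ≠ 0 := 
    fun w y hw => norm_pos_iff.1 (hdpos w y hw)
  have hlb2 : ∀ (w : ℂ) (y : ℝ), |w.im| < ε → c * (1 + Real.exp w.re) ≤ ‖pl y ^ (α:ℂ) - cexp (π * s * I) * cexp w‖ := by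
    intro w y hw
    refine le_trans ?_ (hlb w y hw)
    gcongr; exact hpos y
  have hbd : ∀ (w : ℂ) (y : ℝ), |w.im| < ε → ‖kerF α β s w y‖ ≤ Real.exp 1 * ‖pl y‖ ^ (α - β) * (c * (1 + Real.exp w.re))⁻¹ := by
    intro w y hw
    unfold kerF
    rw [norm_mul, norm_mul, exp_pl, pl_cpow_norm, norm_inv]
    gcongr
    exact hlb2 w y hw
  have hopen : IsOpen {w : ℂ | |w.im| < ε} := isOpen_lt (by fun_prop) continuous_const
  have hcont : ∀ w : ℂ, |w.im| < ε → Continuous (kerF α β s w) := by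
    intro w hw
    unfold kerF
    refine ((Complex.continuous_exp.comp pl_cont).mul (pl_cpow_cont _)).mul ?_
    exact ((pl_cpow_cont _).sub continuous_const).inv₀ (fun y => hne w y hw)
  have hintk : ∀ w : ℂ, |w.im| < ε → Integrable (kerF α β s w) := by
    intro w hw
    refine Integrable.mono' ((hint.const_mul (Real.exp 1)).mul_const ((c * (1 + Real.exp w.re))⁻¹)) (hcont w hw).aestronglyMeasurable ?_
    filter_upwards with y
    exact hbd w y hw
  constructor
  · intro w0 hw0
    apply DifferentiableAt.differentiableWithinAt
    have := hasDerivAt_integral_of_dominated_loc_of_deriv_le (μ := volume)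
      (F := kerF α β s)
      (F' := fun w y => cexp (pl y) * pl y ^ ((α - β : ℝ) : ℂ) * 
        (-(-(cexp (π * s * I) * cexp w)) / (pl y ^ (α:ℂ) - cexp (π * s * I) * cexp w)^2))
      (bound := fun y => Real.exp 1 * ‖pl y‖ ^ (α - β) * (1 / c^2)) (hopen.mem_nhds hw0)
      (by filter_upwards [hopen.mem_nhds hw0] with w hw; exact (hcont w hw).aestronglyMeasurable)
      (hintk w0 hw0)
      (by
        apply Continuous.aestronglyMeasurable
        refine ((Complex.continuous_exp.comp pl_cont).mul (pl_cpow_cont _)).mul ?_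
        exact continuous_const.div (((pl_cpow_cont _).sub continuous_const).pow 2) (fun y => pow_ne_zero 2 (hne w0 y hw0)))
      (by
        filter_upwards with y w hw
        rw [norm_mul, norm_mul, exp_pl, pl_cpow_norm, norm_div, neg_neg, norm_mul, norm_omega, one_mul, Complex.norm_exp, norm_pow]
        gcongr _ * ?_
        have h1 := hlb2 w y hw
        have h3 := hdpos w y hw
        rw [div_le_div_iff₀ (by positivity) (by positivity)]
        have h2 := Real.exp_pos w.re
        calc Real.exp w.re * c^2 ≤ (c * (1 + Real.exp w.re))^2 := by nlinarith [sq_nonneg c, mul_pos hc hc]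
          _ ≤ ‖pl y ^ (α:ℂ) - cexp (π * s * I) * cexp w‖^2 := by gcongr
          _ = _ := by ring)
      ((hint.const_mul _).mul_const _)
      (by
        filter_upwards with y w hw
        unfold kerF
        apply HasDerivAt.const_mul
        have hh : HasDerivAt (fun w => pl y ^ (α:ℂ) - cexp (π * s * I) * cexp w) (-(cexp (π * s * I) * cexp w)) w :=
          ((Complex.hasDerivAt_exp w).const_mul _).const_sub _
        exact hh.fun_inv (hne w y hw))
    exact this.2.differentiableAt
  · refine ⟨(∫ y, ‖pl y‖ ^ (α - β)) * Real.exp 1 * c⁻¹, ?_, fun w hw => ?_⟩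
    · have : 0 ≤ ∫ y, ‖pl y‖ ^ (α - β) := integral_nonneg (fun y => by positivity)
      positivity
    · calc ‖∫ y, kerF α β s w y‖ ≤ ∫ y, Real.exp 1 * ‖pl y‖ ^ (α - β) * (c * (1 + Real.exp w.re))⁻¹ := 
          norm_integral_le_of_norm_le ((hint.const_mul (Real.exp 1)).mul_const _) (by filter_upwards with y using hbd w y hw)
        _ = _ := by
          rw [integral_mul_const, integral_const_mul, mul_inv]; ring

lemma ker_series (α β s : ℝ) (hα : 0 < α) (hβ : 1 < β) (w : ℂ) (hw : w.re < 0) :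
    mittagLeffler α β (cexp (π * s * I) * cexp w) = ∫ y, kerF α β s w y := by
  set z := cexp (π * s * I) * cexp w with hz
  have hzn : ‖z‖ < 1 := by
    rw [hz, norm_mul, norm_omega, one_mul, Complex.norm_exp]; simpa using hw
  have hβ0 : ∀ k : ℕ, 1 < α * k + β := fun k => by
    have : 0 ≤ α * k := by positivity
    linarith
  have hG : ∀ (k : ℕ) y, ‖z ^ k * (cexp (pl y) * pl y ^ (-((α * k + β : ℝ) : ℂ)))‖ ≤ ‖z‖ ^ k * (Real.exp 1 * ‖pl y‖ ^ (-β)) := by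
    intro k y
    rw [norm_mul, norm_mul, exp_pl, norm_pow, ← Complex.ofReal_neg, pl_cpow_norm]
    gcongr
    · exact pl_norm y
    · have : 0 ≤ α * k := by positivity
      linarith
  have hI := (pl_int β hβ).const_mul (Real.exp 1)
  have hGi : ∀ k : ℕ, Integrable (fun y => z ^ k * (cexp (pl y) * pl y ^ (-((α * k + β : ℝ) : ℂ)))) := by
    intro k
    refine Integrable.mono' (hI.const_mul (‖z‖^k)) ?_ (by filter_upwards with y using hG k y)
    exact (continuous_const.mul ((Complex.continuous_exp.comp pl_cont).mul (pl_cpow_cont _))).aestronglyMeasurable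
  have := hasSum_integral_of_summable_integral_norm hGi (by
    refine Summable.of_nonneg_of_le (fun k => integral_nonneg (fun y => norm_nonneg _)) 
      (fun k => integral_mono (hGi k).norm (hI.const_mul (‖z‖^k)) (hG k)) ?_
    simp_rw [integral_const_mul]
    exact (summable_geometric_of_lt_one (norm_nonneg _) hzn).mul_right _)
  have h2 : ∀ y, ∑' k : ℕ, z ^ k * (cexp (pl y) * pl y ^ (-((α * k + β : ℝ) : ℂ))) = kerF α β s w y := by
    intro y
    have hp := pl_ne y
    have hpa : pl y ^ (α:ℂ) ≠ 0 := by simp [Complex.cpow_eq_zero_iff, hp]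
    have hq : ‖z / pl y ^ (α:ℂ)‖ < 1 := by
      rw [norm_div, pl_cpow_norm]
      have := Real.one_le_rpow (pl_norm y) hα.le
      rw [div_lt_one (by linarith)]; linarith
    have h3 : ∀ k : ℕ, z ^ k * (cexp (pl y) * pl y ^ (-((α * k + β : ℝ) : ℂ))) = 
        cexp (pl y) * pl y ^ (-(β:ℂ)) * (z / pl y ^ (α:ℂ)) ^ k := by
      intro k
      have : pl y ^ (-((α * k + β : ℝ) : ℂ)) = pl y ^ (-(β:ℂ)) * ((pl y ^ (α:ℂ)) ^ k)⁻¹ := by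
        rw [← Complex.cpow_mul_nat, ← Complex.cpow_neg, ← Complex.cpow_add _ _ hp]
        congr 1; push_cast; ring
      rw [this, div_pow]; field_simp
    simp_rw [h3]
    rw [tsum_mul_left, tsum_geometric_of_norm_lt_one hq]
    unfold kerF
    rw [← hz]
    have h4 : pl y ^ ((α - β : ℝ) : ℂ) = pl y ^ (-(β:ℂ)) * pl y ^ (α:ℂ) := by
      rw [← Complex.cpow_add _ _ hp]; congr 1; push_cast; ring
    have h5 : (1 - z / pl y ^ (α:ℂ)) = (pl y ^ (α:ℂ) - z) / pl y ^ (α:ℂ) := by field_simp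
    rw [h4, h5, inv_div]; ring
  simp_rw [h2] at this
  rw [← this.tsum_eq]
  unfold mittagLeffler
  congr 1
  funext k
  rw [integral_const_mul, brom _ (hβ0 k)]
  ring

lemma SB_big (α β s : ℝ) (hα : 0 < α) (hα2 : α < 2)
    (hs1 : -1 < s) (hs2 : s ≤ 1) (hs3 : α / 2 < |s|) (hβ : 3 < β) :
    SB (fun w => mittagLeffler α β (cexp (π * s * I) * cexp w)) := by
  have hent := ml_entire α β hα (by linarith) _ (norm_omega s)
  refine ⟨hent, ?_⟩
  obtain ⟨ε, hε, c, hc, hlb⟩ := den_lb α s hα hα2 hs1 hs2 hs3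
  obtain ⟨hd, C, hC, hb⟩ := ker_main α β s hα (by linarith) ε c hε hc hlb
  refine ⟨ε, hε, C, hC, fun w hw => ?_⟩
  have hopen : IsOpen {w : ℂ | |w.im| < ε} := isOpen_lt (by fun_prop) continuous_const
  have hpre : IsPreconnected {w : ℂ | |w.im| < ε} := by
    have : {w : ℂ | |w.im| < ε} = {w : ℂ | -ε < w.im} ∩ {w : ℂ | w.im < ε} := by
      ext w; simp [abs_lt]
    rw [this]
    exact ((convex_halfSpace_im_gt _).inter (convex_halfSpace_im_lt _)).isPreconnected
  have heq := AnalyticOnNhd.eqOn_of_preconnected_of_eventuallyEq (hent.differentiableOn.analyticOnNhd hopen)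
    (hd.analyticOnNhd hopen) hpre (z₀ := -1) (by simpa using hε) (by
      have : {w : ℂ | w.re < 0} ∈ nhds (-1 : ℂ) := (mlF_open 0).mem_nhds (by simp)
      filter_upwards [this] with w hw
      exact ker_series α β s hα (by linarith) w hw)
  have := heq hw
  simp only at this ⊢
  rw [this]
  exact hb w hw

lemma SB_all (α β s : ℝ) (hα : 0 < α) (hα2 : α < 2)
    (hs1 : -1 < s) (hs2 : s ≤ 1) (hs3 : α / 2 < |s|) (hβ : 0 < β) :
    SB (fun w => mittagLeffler α β (cexp (π * s * I) * cexp w)) := by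
  have step : ∀ β > 0, SB (fun w => mittagLeffler α (β+1) (cexp (π * s * I) * cexp w)) → 
      SB (fun w => mittagLeffler α β (cexp (π * s * I) * cexp w)) := by
    intro β hβ h
    have := h.deriv.comb h (α:ℂ) (β:ℂ)
    convert this using 2 with w
    exact ml_rec α β hα hβ _ (norm_omega s) w
  apply step β hβ
  apply step _ (by linarith)
  apply step _ (by linarith)
  apply step _ (by linarith)
  exact SB_big α _ s hα hα2 hs1 hs2 hs3 (by linarith)

lemma cs_bdd {d : ℕ} {G : Type*} [NormedAddCommGroup G] [NormedSpace ℝ G] (f : EuclideanSpace ℝ (Fin d) → G)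
    (hf : ContDiff ℝ (⊤:ℕ∞) f) (hc : HasCompactSupport f) (n : ℕ) :
    ∃ B : ℝ, 0 ≤ B ∧ ∀ i ≤ n, ∀ x, ‖iteratedFDeriv ℝ i f x‖ ≤ B := by
  have h : ∀ i : ℕ, ∃ B : ℝ, ∀ x, ‖iteratedFDeriv ℝ i f x‖ ≤ B := fun i =>
    (hf.continuous_iteratedFDeriv (m := i) (by exact_mod_cast le_top)).bounded_above_of_compact_support (hc.iteratedFDeriv i)
  choose B hB using h
  have hB0 : ∀ i, 0 ≤ B i := fun i => (norm_nonneg _).trans (hB i 0)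
  refine ⟨∑ i ∈ Finset.range (n+1), B i, Finset.sum_nonneg (fun i _ => hB0 i), fun i hi x => (hB i x).trans ?_⟩
  exact Finset.single_le_sum (f := B) (fun i _ => hB0 i) (Finset.mem_range.2 (by omega))

lemma comp_bd {d : ℕ} (f : ℂ → ℂ) (hf : SB f) (γ : ℝ) (hγ : 0 < γ) (ψ L : EuclideanSpace ℝ (Fin d) → ℝ)
    (hψ : ContDiff ℝ (⊤:ℕ∞) ψ) (hψc : HasCompactSupport ψ) (hL : ContDiff ℝ (⊤:ℕ∞) L) (hLc : HasCompactSupport L) (n : ℕ) :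
    ∃ C : ℝ, 0 ≤ C ∧ ∀ m ≤ n, ∀ (j : ℤ) x,
      ‖iteratedFDeriv ℝ m (fun η => (ψ η : ℂ) * f ((γ * (j * Real.log 2) + γ * L η : ℝ) : ℂ)) x‖ 
        ≤ C * (2:ℝ) ^ (if 0 < j then -γ * (j:ℝ) else 0) := by
  set Ψ : EuclideanSpace ℝ (Fin d) → ℂ := fun η => (ψ η : ℂ) with hΨ
  have hΨs : ContDiff ℝ (⊤:ℕ∞) Ψ := Complex.ofRealCLM.contDiff.comp hψ
  have hΨc : HasCompactSupport Ψ := hψc.comp_left (g := fun x : ℝ => (x:ℂ)) (by simp)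
  obtain ⟨B, hB0, hB⟩ := cs_bdd Ψ hΨs hΨc n
  obtain ⟨D, hD0, hD⟩ := cs_bdd L hL hLc n
  obtain ⟨M, hM⟩ := hL.continuous.bounded_above_of_compact_support hLc
  have hM0 : 0 ≤ M := (norm_nonneg _).trans (hM 0)
  have hk : ∀ i : ℕ, ∃ C : ℝ, 0 ≤ C ∧ ∀ (j : ℤ) (t : ℝ), |t| ≤ M →
      ‖iteratedFDeriv ℝ i (fun t : ℝ => f ((γ * (j * Real.log 2) + γ * t : ℝ) : ℂ)) t‖ ≤ C * (2:ℝ) ^ (if 0 < j then -γ * (j:ℝ) else 0) := by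
    intro i
    obtain ⟨g, hg, hgi⟩ := hf.iter γ i
    obtain ⟨C, hC, hb⟩ := hg.unif γ M hγ hM0
    refine ⟨C, hC, fun j t ht => ?_⟩
    rw [norm_iteratedFDeriv_eq_norm_iteratedDeriv, hgi]
    exact hb j t ht
  choose Ck hCk0 hCk using hk
  set CC := ∑ i ∈ Finset.range (n+1), Ck i with hCC
  have hCC0 : 0 ≤ CC := Finset.sum_nonneg (fun i _ => hCk0 i)
  have hCCle : ∀ i ≤ n, Ck i ≤ CC := fun i hi =>
    Finset.single_le_sum (f := Ck) (fun i _ => hCk0 i) (Finset.mem_range.2 (by omega))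
  have key : ∀ m ≤ n, ∀ (j : ℤ) x,
      ‖iteratedFDeriv ℝ m (fun η => Ψ η * f ((γ * (j * Real.log 2) + γ * L η : ℝ) : ℂ)) x‖ 
        ≤ (∑ i ∈ Finset.range (m+1), (m.choose i : ℝ) * B * (((m-i).factorial : ℝ) * CC * (1 + D) ^ (m-i))) * (2:ℝ) ^ (if 0 < j then -γ * (j:ℝ) else 0) := by
    intro m hm j x
    set A := (2:ℝ) ^ (if 0 < j then -γ * (j:ℝ) else 0) with hA
    have hA0 : 0 ≤ A := by positivity
    have hs := (hf.smooth (γ * (j * Real.log 2)) γ)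
    have hcomp : ContDiff ℝ (⊤:ℕ∞) (fun η => f ((γ * (j * Real.log 2) + γ * L η : ℝ) : ℂ)) := hs.comp hL
    refine (norm_iteratedFDeriv_mul_le hΨs hcomp x (n := m) (by exact_mod_cast le_top)).trans ?_
    rw [Finset.sum_mul]
    apply Finset.sum_le_sum
    intro i hi
    have hi' : i ≤ m := by simp at hi; omega
    have h1 := hB i (by omega) x
    have h2 : ‖iteratedFDeriv ℝ (m-i) (fun η => f ((γ * (j * Real.log 2) + γ * L η : ℝ) : ℂ)) x‖ ≤
        ((m-i).factorial : ℝ) * (CC * A) * (1 + D) ^ (m-i) := by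
      have htop0 : ∀ q : ℕ, (q : WithTop ℕ∞) ≤ ((⊤:ℕ∞) : WithTop ℕ∞) := fun q => by exact_mod_cast le_top
      have htop := htop0 (m-i)
      refine norm_iteratedFDeriv_comp_le hs hL htop x ?_ ?_
      · intro l hl
        refine (hCk l j (L x) (hM x)).trans ?_
        gcongr
        exact hCCle l (by omega)
      · intro l hl hl2
        refine (hD l (by omega) x).trans ?_
        calc D ≤ 1 + D := by linarith
          _ ≤ (1 + D) ^ l := le_self_pow₀ (by linarith) (by omega)
    calc _ ≤ (m.choose i : ℝ) * B * (((m-i).factorial : ℝ) * (CC * A) * (1 + D) ^ (m-i)) := by gcongr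
      _ = _ := by ring
  have hS0 : ∀ m, 0 ≤ (∑ i ∈ Finset.range (m+1), (m.choose i : ℝ) * B * (((m-i).factorial : ℝ) * CC * (1 + D) ^ (m-i))) :=
    fun m => Finset.sum_nonneg (fun i _ => by positivity)
  refine ⟨∑ m ∈ Finset.range (n+1), (∑ i ∈ Finset.range (m+1), (m.choose i : ℝ) * B * (((m-i).factorial : ℝ) * CC * (1 + D) ^ (m-i))),
    Finset.sum_nonneg (fun m _ => hS0 m), fun m hm j x => (key m hm j x).trans ?_⟩
  gcongr
  exact Finset.single_le_sum (f := fun m => (∑ i ∈ Finset.range (m+1), (m.choose i : ℝ) * B * (((m-i).factorial : ℝ) * CC * (1 + D) ^ (m-i)))) 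
    (fun i _ => hS0 i) (Finset.mem_range.2 (by omega))

lemma fourier_decay (d : ℕ) : ∃ K : ℝ, 0 ≤ K ∧ ∀ (g : EuclideanSpace ℝ (Fin d) → ℂ) (A : ℝ),
    ContDiff ℝ (⊤:ℕ∞) g → (∀ x, 2 < ‖x‖ → g x = 0) → 
    (∀ m ≤ d+1, ∀ x, ‖iteratedFDeriv ℝ m g x‖ ≤ A) →
    ∀ x, ‖𝓕⁻ g x‖ ≤ K * A * (1 + ‖x‖) ^ (-((d:ℝ)+1)) := by
  set V : ℝ := (volume (Metric.closedBall (0 : EuclideanSpace ℝ (Fin d)) 2)).toReal with hV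
  refine ⟨2 ^ d * (V + 2 ^ (d+1) * ((d+2) * V)), by positivity, ?_⟩
  intro g A hg hsupp hA x
  have hts : tsupport g ⊆ Metric.closedBall 0 2 := by
    apply closure_minimal _ Metric.isClosed_closedBall
    intro y hy
    by_contra h
    simp at h
    exact hy (hsupp y h)
  have hcs : HasCompactSupport g := (isCompact_closedBall _ _).of_isClosed_subset (isClosed_tsupport g) hts
  have hI : ∀ m ≤ d+1, ∫ v, ‖iteratedFDeriv ℝ m g v‖ ≤ A * V := by
    intro m hm
    have hz : ∀ v, v ∉ Metric.closedBall (0 : EuclideanSpace ℝ (Fin d)) 2 → ‖iteratedFDeriv ℝ m g v‖ = 0 := by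
      intro v hv
      rw [norm_eq_zero]
      by_contra h
      exact hv (hts (support_iteratedFDeriv_subset m h))
    rw [← setIntegral_eq_integral_of_forall_compl_eq_zero hz]
    calc _ ≤ ∫ v in Metric.closedBall (0 : EuclideanSpace ℝ (Fin d)) 2, A := by
          apply setIntegral_mono_on _ (integrableOn_const (measure_closedBall_lt_top.ne)) Metric.isClosed_closedBall.measurableSet
            (fun v _ => hA m hm v)
          apply ContinuousOn.integrableOn_compact (isCompact_closedBall _ _)
          exact (hg.continuous_iteratedFDeriv (m := m) (by exact_mod_cast le_top)).norm.continuousOn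
      _ = A * V := by rw [setIntegral_const, smul_eq_mul, mul_comm]; rfl
  have hA0 : 0 ≤ A := (norm_nonneg _).trans (hA 0 (by omega) 0)
  have hF : ∀ n ≤ d+1, ‖x‖ ^ n * ‖𝓕⁻ g x‖ ≤ 2 ^ n * ((n+1) * (A * V)) := by
    intro n hn
    have := Real.pow_mul_norm_iteratedFDeriv_fourier_le (f := g) (K := ⊤) (N := ⊤) hg (by
      intro k m _ _
      apply Continuous.integrable_of_hasCompactSupport
      · exact (continuous_norm.pow k).mul (hg.continuous_iteratedFDeriv (m := m) (by exact_mod_cast le_top)).norm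
      · exact ((hcs.iteratedFDeriv m).norm).mul_left) (k := 0) (n := n) le_top le_top (-x)
    rw [norm_iteratedFDeriv_zero, norm_neg, ← Real.fourierInv_eq_fourier_neg] at this
    refine this.trans ?_
    simp only [pow_zero, one_mul, Nat.cast_zero, mul_zero, zero_add]
    gcongr
    calc _ ≤ ∑ p ∈ Finset.range 1 ×ˢ Finset.range (n + 1), A * V := by
          apply Finset.sum_le_sum
          intro p hp
          rw [Finset.mem_product, Finset.mem_range, Finset.mem_range] at hp
          rw [Nat.lt_one_iff.1 hp.1]
          simp only [pow_zero, one_mul]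
          exact hI p.2 (by omega)
      _ = _ := by simp
  have h0 := hF 0 (by omega)
  have h1 := hF (d+1) le_rfl
  have h2 := add_pow_le (zero_le_one) (norm_nonneg x) (d+1)
  simp only [one_pow, Nat.add_sub_cancel] at h2
  rw [Real.rpow_neg (by positivity), ← div_eq_mul_inv, le_div_iff₀ (by positivity)]
  have : (1 + ‖x‖) ^ ((d:ℝ)+1) = (1 + ‖x‖) ^ (d+1) := by rw [← Real.rpow_natCast]; push_cast; rfl
  rw [this]
  calc ‖𝓕⁻ g x‖ * (1 + ‖x‖) ^ (d+1) ≤ ‖𝓕⁻ g x‖ * (2 ^ d * (1 + ‖x‖ ^ (d+1))) := by gcongr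
    _ = 2 ^ d * (‖x‖^0 * ‖𝓕⁻ g x‖ + ‖x‖ ^ (d+1) * ‖𝓕⁻ g x‖) := by ring
    _ ≤ 2 ^ d * (2 ^ 0 * (((0:ℕ)+1) * (A * V)) + 2 ^ (d+1) * (((d+1 : ℕ)+1) * (A * V))) := by gcongr
    _ = _ := by push_cast; ring

lemma fourierInv_scale {d : ℕ} (g : EuclideanSpace ℝ (Fin d) → ℂ) (c : ℝ) (hc : 0 < c) (x : EuclideanSpace ℝ (Fin d)) :
    𝓕⁻ (fun ξ => g (c⁻¹ • ξ)) x = ((c ^ d : ℝ) : ℂ) * 𝓕⁻ g (c • x) := by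
  rw [Real.fourierInv_eq', Real.fourierInv_eq']
  have h := Measure.integral_comp_smul (volume : Measure (EuclideanSpace ℝ (Fin d))) 
    (fun v => cexp (((2 * π * inner ℝ v (c • x) : ℝ) : ℂ) * I) • g v) c⁻¹
  simp only [finrank_euclideanSpace, Fintype.card_fin, inv_pow, inv_inv] at h
  rw [abs_of_pos (by positivity)] at h
  rw [← Complex.real_smul, ← h]
  congr 1
  funext v
  congr 4
  rw [inner_smul_left, inner_smul_right]
  simp
  field_simp

lemma japanese_memLp (d : ℕ) (p : ℝ≥0∞) (hp : 1 ≤ p) : 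
    MemLp (fun x : EuclideanSpace ℝ (Fin d) => (1 + ‖x‖) ^ (-((d:ℝ)+1))) p volume := by
  have hi := integrable_one_add_norm (E := EuclideanSpace ℝ (Fin d)) (μ := volume) (r := (d:ℝ)+1) (by simp)
  have hd0 : (0:ℝ) ≤ d := by positivity
  by_cases hpt : p = ⊤
  · subst hpt
    apply memLp_top_of_bound hi.1 1
    filter_upwards with x
    rw [Real.norm_of_nonneg (by positivity)]
    apply Real.rpow_le_one_of_one_le_of_nonpos
    · linarith [norm_nonneg x]
    · linarith
  · have hp1 : 1 ≤ p.toReal := by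
      have := ENNReal.toReal_mono hpt hp
      simpa using this
    rw [← integrable_norm_rpow_iff hi.1 (by positivity) hpt]
    have h3 := integrable_one_add_norm (E := EuclideanSpace ℝ (Fin d)) (μ := volume) (r := ((d:ℝ)+1) * p.toReal) (by 
      simp; nlinarith)
    refine h3.congr ?_
    filter_upwards with x
    rw [Real.norm_of_nonneg (by positivity), ← Real.rpow_mul (by positivity)]
    congr 1; ring

lemma eLp_scale {d : ℕ} (h : EuclideanSpace ℝ (Fin d) → ℝ) (hm : AEStronglyMeasurable h volume) (p : ℝ≥0∞) (c : ℝ) (hc : 0 < c) :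
    eLpNorm (fun x => h (c • x)) p volume = ENNReal.ofReal ((c ^ d)⁻¹) ^ (1/p).toReal * eLpNorm h p volume := by
  have hmap := Measure.map_addHaar_smul (volume : Measure (EuclideanSpace ℝ (Fin d))) hc.ne'
  simp only [finrank_euclideanSpace, Fintype.card_fin] at hmap
  rw [abs_of_pos (by positivity)] at hmap
  have h1 := eLpNorm_map_measure (p := p) (μ := (volume : Measure (EuclideanSpace ℝ (Fin d)))) (f := fun x => c • x) (g := h)
    (by rw [hmap]; exact hm.smul_measure _) (by fun_prop)
  rw [hmap, eLpNorm_smul_measure_of_ne_zero (by simp; positivity)] at h1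
  rw [← smul_eq_mul, h1]; rfl

lemma cutoff_log (d : ℕ) (φ : EuclideanSpace ℝ (Fin d) → ℝ)
    (hsmooth : ContDiff ℝ (⊤ : ℕ∞) φ)
    (hsupp : Function.support φ ⊆ Metric.closedBall 0 2)
    (hone : ∀ x : EuclideanSpace ℝ (Fin d), ‖x‖ ≤ 1 → φ x = 1) :
    ∃ L : EuclideanSpace ℝ (Fin d) → ℝ, ContDiff ℝ (⊤ : ℕ∞) L ∧ HasCompactSupport L ∧
      ∀ x, 1/4 < ‖x‖ → ‖x‖ ≤ 4 → L x = Real.log ‖x‖ := by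
  have hz : ∀ x, 2 < ‖x‖ → φ x = 0 := by
    intro x hx
    by_contra h
    have := hsupp h
    simp at this; linarith
  have hn : ∀ (c : ℝ) (x : EuclideanSpace ℝ (Fin d)), 0 < c → ‖c • x‖ = c * ‖x‖ := by
    intro c x hc; rw [norm_smul, Real.norm_of_nonneg hc.le]
  refine ⟨fun x => (φ ((1/4:ℝ) • x) - φ ((8:ℝ) • x)) * Real.log ‖x‖, ?_, ?_, ?_⟩
  · rw [contDiff_iff_contDiffAt]
    intro x
    by_cases hx : x = 0
    · subst hx
      have : (fun x : EuclideanSpace ℝ (Fin d) => (φ ((1/4:ℝ) • x) - φ ((8:ℝ) • x)) * Real.log ‖x‖) =ᶠ[nhds 0] fun _ => 0 := by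
        filter_upwards [Metric.ball_mem_nhds 0 (by norm_num : (0:ℝ) < 1/8)] with x hx
        have hx : ‖x‖ < 1/8 := by simpa using hx
        rw [hone _ (by rw [hn _ _ (by norm_num)]; linarith), hone _ (by rw [hn _ _ (by norm_num)]; linarith)]
        simp
      exact contDiffAt_const.congr_of_eventuallyEq this
    · apply ContDiffAt.mul
      · apply ContDiff.contDiffAt
        exact (hsmooth.comp (contDiff_const_smul _)).sub (hsmooth.comp (contDiff_const_smul _))
      · exact (contDiffAt_norm ℝ hx).log (norm_ne_zero_iff.2 hx)
  · apply HasCompactSupport.intro (isCompact_closedBall 0 8)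
    intro x hx
    have hx : 8 < ‖x‖ := by simpa using hx
    rw [hz _ (by rw [hn _ _ (by norm_num)]; linarith), hz _ (by rw [hn _ _ (by norm_num)]; linarith)]
    simp
  · intro x h1 h2
    simp only
    rw [hone _ (by rw [hn _ _ (by norm_num)]; linarith), hz _ (by rw [hn _ _ (by norm_num)]; linarith)]
    simp



/-- The Littlewood–Paley pieces of the (inverse) Fourier transform of
`E_{α,β}(e^{iπs}|·|^γ)` satisfy `‖P_j (E_{α,β}(e^{iπs}|·|^γ))^∨‖_{L^p} ≤ C 2^{d(1−1/p)j + δ(j)}`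
uniformly in `j ∈ ℤ`, where `δ(j) = −γj` for `j > 0` and `δ(j) = 0` otherwise. Since the
Fourier transform of `P_j (E_{α,β}(e^{iπs}|·|^γ))^∨` is the compactly supported bounded
function `ξ ↦ (φ(ξ/2^j) − φ(ξ/2^{j−1})) E_{α,β}(e^{iπs}|ξ|^γ)`, the piece itself is the
(absolutely convergent) inverse Fourier integral of that function. -/
theorem stmt13 (d : ℕ) (hd : 0 < d) (α β γ s : ℝ)
    (hα : 0 < α) (hα2 : α < 2) (hβ : 0 < β) (hγ : 0 < γ)
    (hs1 : -1 < s) (hs2 : s ≤ 1) (hs3 : α / 2 < |s|)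
    (φ : EuclideanSpace ℝ (Fin d) → ℝ)
    (hsmooth : ContDiff ℝ (⊤ : ℕ∞) φ)
    (hsupp : Function.support φ ⊆ Metric.closedBall 0 2)
    (hone : ∀ x : EuclideanSpace ℝ (Fin d), ‖x‖ ≤ 1 → φ x = 1)
    (hrad : ∀ x y : EuclideanSpace ℝ (Fin d), ‖x‖ = ‖y‖ → φ x = φ y)
    (p : ℝ≥0∞) (hp : 1 ≤ p) :
    ∃ C : ℝ, 0 < C ∧ ∀ j : ℤ,
      eLpNorm (𝓕⁻ (fun ξ : EuclideanSpace ℝ (Fin d) =>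
          ((φ (((2 : ℝ) ^ (-j) : ℝ) • ξ) - φ (((2 : ℝ) ^ (1 - j) : ℝ) • ξ) : ℝ) : ℂ) *
            mittagLeffler α β (Complex.exp (π * s * Complex.I) * ((‖ξ‖ ^ γ : ℝ) : ℂ))))
        p volume ≤
      ENNReal.ofReal (C * (2 : ℝ) ^ ((d : ℝ) * (1 - (1 / p).toReal) * (j : ℝ) +
        (if 0 < j then -γ * (j : ℝ) else 0))) := by
  obtain ⟨L, hL, hLc, hLlog⟩ := cutoff_log d φ hsmooth hsupp hone
  have hz : ∀ x, 2 < ‖x‖ → φ x = 0 := by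
    intro x hx
    by_contra h
    have := hsupp h
    simp at this; linarith
  set ψ : EuclideanSpace ℝ (Fin d) → ℝ := fun x => φ x - φ ((2:ℝ) • x) with hψdef
  have hψ : ContDiff ℝ (⊤ : ℕ∞) ψ := hsmooth.sub (hsmooth.comp (contDiff_const_smul _))
  have hn2 : ∀ x : EuclideanSpace ℝ (Fin d), ‖(2:ℝ) • x‖ = 2 * ‖x‖ := fun x => by rw [norm_smul]; simp
  have hψz : ∀ x, 2 < ‖x‖ → ψ x = 0 := by
    intro x hx
    simp only [hψdef]
    rw [hz x hx, hz _ (by rw [hn2]; linarith)]; simp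
  have hψc : HasCompactSupport ψ := by
    apply HasCompactSupport.intro (isCompact_closedBall 0 2)
    intro x hx
    exact hψz x (by simpa using hx)
  have hψ0 : ∀ x, ‖x‖ ≤ 1/2 → ψ x = 0 := by
    intro x hx
    simp only [hψdef]
    rw [hone x (by linarith), hone _ (by rw [hn2]; linarith)]; simp
  have hSB := SB_all α β s hα hα2 hs1 hs2 hs3 hβ
  set f : ℂ → ℂ := fun w => mittagLeffler α β (cexp (π * s * I) * cexp w) with hf
  obtain ⟨C, hC0, hC⟩ := comp_bd f hSB γ hγ ψ L hψ hψc hL hLc (d+1)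
  obtain ⟨K, hK0, hK⟩ := fourier_decay d
  have hmem := japanese_memLp d p hp
  set h : EuclideanSpace ℝ (Fin d) → ℝ := fun x => (1 + ‖x‖) ^ (-((d:ℝ)+1)) with hh
  set Q := (eLpNorm h p volume).toReal with hQ
  have hQ' : eLpNorm h p volume = ENNReal.ofReal Q := (ENNReal.ofReal_toReal hmem.2.ne).symm
  have hQ0 : 0 ≤ Q := ENNReal.toReal_nonneg
  refine ⟨K * C * Q + 1, by positivity, fun j => ?_⟩
  set A : ℝ := (2:ℝ) ^ (if 0 < j then -γ * (j:ℝ) else 0) with hA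
  have hA0 : 0 ≤ A := by positivity
  set c : ℝ := (2:ℝ) ^ j with hc
  have hc0 : 0 < c := by positivity
  set g : EuclideanSpace ℝ (Fin d) → ℂ := fun η => (ψ η : ℂ) * f ((γ * (j * Real.log 2) + γ * L η : ℝ) : ℂ) with hg
  have hgs : ContDiff ℝ (⊤ : ℕ∞) g := 
    (Complex.ofRealCLM.contDiff.comp hψ).mul ((hSB.smooth (γ * (j * Real.log 2)) γ).comp hL)
  have hgd := hK g (C * A) hgs (fun x hx => by simp [hg, hψz x hx]) (fun m hm x => hC m hm j x)
  have hfun : (fun ξ : EuclideanSpace ℝ (Fin d) =>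
          ((φ (((2 : ℝ) ^ (-j) : ℝ) • ξ) - φ (((2 : ℝ) ^ (1 - j) : ℝ) • ξ) : ℝ) : ℂ) *
            mittagLeffler α β (Complex.exp (π * s * Complex.I) * ((‖ξ‖ ^ γ : ℝ) : ℂ))) = fun ξ => g (c⁻¹ • ξ) := by
    funext ξ
    have e1 : (2:ℝ) ^ (-j) = c⁻¹ := by rw [hc, zpow_neg]
    have e2 : ((2:ℝ) ^ (1-j)) • ξ = (2:ℝ) • (c⁻¹ • ξ) := by
      rw [smul_smul, zpow_sub₀ (by norm_num), zpow_one, hc]; rfl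
    rw [e1, e2]
    have e3 : φ (c⁻¹ • ξ) - φ ((2:ℝ) • (c⁻¹ • ξ)) = ψ (c⁻¹ • ξ) := rfl
    rw [e3]
    set η := c⁻¹ • ξ with hη
    by_cases hψη : ψ η = 0
    · simp [hg, hψη]
    have h1 : 1/2 < ‖η‖ := by by_contra hcon; exact hψη (hψ0 η (by linarith))
    have h2 : ‖η‖ ≤ 2 := by by_contra hcon; exact hψη (hψz η (by linarith))
    simp only [hg, hf]
    rw [hLlog η (by linarith) (by linarith), ← Complex.ofReal_exp]
    congr 4
    have hξ : ‖ξ‖ = c * ‖η‖ := by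
      rw [hη, norm_smul, norm_inv, Real.norm_of_nonneg hc0.le]; field_simp
    have hη0 : 0 < ‖η‖ := by linarith
    rw [hξ, Real.rpow_def_of_pos (by positivity), Real.log_mul hc0.ne' hη0.ne', hc, Real.log_zpow]
    congr 1; ring
  rw [hfun]
  calc eLpNorm (𝓕⁻ (fun ξ => g (c⁻¹ • ξ))) p volume 
      ≤ eLpNorm ((c ^ d * (K * (C * A))) • (fun x => h (c • x))) p volume := by
        apply eLpNorm_mono_real
        intro x
        rw [fourierInv_scale g c hc0 x, norm_mul, Complex.norm_real, Real.norm_of_nonneg (by positivity)]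
        simp only [Pi.smul_apply, smul_eq_mul]
        rw [mul_assoc]
        gcongr
        exact hgd _
    _ = ENNReal.ofReal ((c ^ d * (K * (C * A))) * ((c ^ d)⁻¹ ^ (1/p).toReal * Q)) := by
        rw [eLpNorm_const_smul, eLp_scale h hmem.1 p c hc0, hQ', Real.enorm_of_nonneg (by positivity), 
          ENNReal.ofReal_rpow_of_pos (by positivity), ← ENNReal.ofReal_mul (by positivity), ← ENNReal.ofReal_mul (by positivity)]
    _ ≤ _ := by
        apply ENNReal.ofReal_le_ofReal
        have e1 : c ^ d = (2:ℝ) ^ ((d:ℝ) * j) := by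
          rw [hc, mul_comm, Real.rpow_mul (by norm_num), Real.rpow_intCast, Real.rpow_natCast]
        have e2 : c ^ d * (c ^ d)⁻¹ ^ (1/p).toReal = (2:ℝ) ^ ((d : ℝ) * (1 - (1 / p).toReal) * (j : ℝ)) := by
          rw [e1, ← Real.rpow_neg (by norm_num), ← Real.rpow_mul (by norm_num), ← Real.rpow_add (by norm_num)]
          congr 1; ring
        rw [Real.rpow_add (by norm_num), ← hA, ← e2]
        set T := c ^ d * (c ^ d)⁻¹ ^ (1/p).toReal with hT
        have hT0 : 0 ≤ T := by positivity
        calc _ = K * C * Q * (T * A) := by rw [hT]; ring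
          _ ≤ _ := by gcongr; linarith
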